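/- Let G be a finite simple bipartite undirected graph, let χ be a partial edge coloring of G, let (u,v) be an edge of G, and let α, β be distinct colors with α ∈ miss_χ(u) and β ∈ miss_χ(v). Then the maximal {α,β}-alternating path starting at u does not have v as its other endpoint. -/

import Mathlib

/-- A partial `κ`-edge coloring of a simple graph `G`: edges may be uncolored (`none`),
and any two distinct colored edges sharing an endpoint receive distinct colors. -/
def IsPartialEdgeColoring {V : Type*} (G : SimpleGraph V) {κ : ℕ}
    (χ : Sym2 V → Option (Fin κ)) : Prop :=
  ∀ e ∈ G.edgeSet, ∀ f ∈ G.edgeSet, e ≠ f → (∃ v : V, v ∈ e ∧ v ∈ f) →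
    χ e ≠ none → χ f ≠ none → χ e ≠ χ f

/-- The color `c` is missing at the vertex `x`: no edge of `G` incident on `x` has color `c`. -/
def MissingAt {V : Type*} (G : SimpleGraph V) {κ : ℕ}
    (χ : Sym2 V → Option (Fin κ)) (x : V) (c : Fin κ) : Prop :=
  ∀ e ∈ G.edgeSet, x ∈ e → χ e ≠ some c

/-- A walk `P` is an `{α,β}`-alternating path for the partial coloring `χ` if its successive
edges are colored `α, β, α, β, …` or `β, α, β, α, …`. -/
def IsAltPath {V : Type*} (G : SimpleGraph V) {κ : ℕ} (χ : Sym2 V → Option (Fin κ))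
    (α β : Fin κ) {u v : V} (P : G.Walk u v) : Prop :=
  (∀ (i : ℕ) (h : i < P.edges.length),
      χ (P.edges[i]'h) = some (if i % 2 = 0 then α else β)) ∨
  (∀ (i : ℕ) (h : i < P.edges.length),
      χ (P.edges[i]'h) = some (if i % 2 = 0 then β else α))

/-- An `{α,β}`-alternating path is maximal if at each of its endpoints at least one of the
colors `α`, `β` is missing. -/
def IsMaximalAltPath {V : Type*} (G : SimpleGraph V) {κ : ℕ} (χ : Sym2 V → Option (Fin κ))
    (α β : Fin κ) {u v : V} (P : G.Walk u v) : Prop :=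
  IsAltPath G χ α β P ∧
    (MissingAt G χ u α ∨ MissingAt G χ u β) ∧
    (MissingAt G χ v α ∨ MissingAt G χ v β)

/-- A walk between adjacent vertices of a bipartite graph has odd length. -/
theorem SimpleGraph.Walk.odd_length_of_adj_of_colorable_two {V : Type*} {G : SimpleGraph V}
    (hbip : G.Colorable 2) {u v : V} (huv : G.Adj u v) (P : G.Walk u v) : Odd P.length := by
  have c : G.Coloring Bool := hbip.toColoring (by simp)
  rw [c.odd_length_iff_not_congr P]
  have h := c.valid huv
  cases hcu : c u <;> cases hcv : c v <;> simp_all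

/-- The edge with index `i` of a walk joins its vertices with indices `i` and `i + 1`. -/
theorem SimpleGraph.Walk.getElem_edges_eq_mk_getVert {V : Type*} {G : SimpleGraph V} {u v : V}
    (P : G.Walk u v) {i : ℕ} (h : i < P.edges.length) :
    P.edges[i] = s(P.getVert i, P.getVert (i + 1)) := by
  rw [getElem_edges_eq_edge_getElem_darts, darts_getElem_eq_getVert]
  rfl

/-- In a finite simple **bipartite** graph, if `(u,v)` is an edge, `α ∈ miss_χ(u)` and
`β ∈ miss_χ(v)` with `α ≠ β`, then the maximal `{α,β}`-alternating path starting at `u`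
does not have `v` as its other endpoint: there is no maximal `{α,β}`-alternating path
from `u` to `v`. -/
theorem bipartite_alt_path_avoids_other_endpoint {V : Type*} [Fintype V]
    (G : SimpleGraph V) (hbip : G.Colorable 2) {κ : ℕ}
    (χ : Sym2 V → Option (Fin κ)) (hχ : IsPartialEdgeColoring G χ)
    (u v : V) (huv : G.Adj u v) (α β : Fin κ) (hαβ : α ≠ β)
    (hu : MissingAt G χ u α) (hv : MissingAt G χ v β)
    (P : G.Walk u v) (hP : P.IsPath) (hmax : IsMaximalAltPath G χ α β P) : False := by
  have hodd := P.odd_length_of_adj_of_colorable_two hbip huv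
  have hpos : 0 < P.edges.length := by simpa using hodd.pos
  have hlast : P.length - 1 < P.edges.length := by simpa using hodd.pos
  rcases hmax.1 with h | h
  · refine hu _ (P.edges_subset_edgeSet (List.getElem_mem hpos)) ?_ (by simpa using h 0 hpos)
    simp [P.getElem_edges_eq_mk_getVert]
  · have heven : (P.length - 1) % 2 = 0 := by grind
    refine hv _ (P.edges_subset_edgeSet (List.getElem_mem hlast)) ?_
      (by simpa [heven] using h _ hlast)
    rw [P.getElem_edges_eq_mk_getVert, Nat.sub_add_cancel hodd.pos, P.getVert_length]
    exact Sym2.mem_mk_right _ _
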